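/- arXiv:math/0206088 — 5 statements merged into one kernel-verified Lean document; each statement's English description precedes it below -/
import Mathlib

section
/- Let H be a complex Hilbert space and β : H → H a continuous linear operator with β ∘ β = 0. If the operator S := −i(β − β*) (where β* is the Hilbert-space adjoint) is invertible modulo compact operators, then there exists a continuous linear operator g : H → H such that β ∘ g + g ∘ β − id is a compact operator. -/
open ContinuousLinearMap

/-- The two-sided ideal of compact operators in the ring of bounded operators. -/
def compactOperatorIdeal (𝕜 E : Type*) [NontriviallyNormedField 𝕜] [NormedAddCommGroup E]
    [NormedSpace 𝕜 E] : TwoSidedIdeal (E →L[𝕜] E) :=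
  .mk' {T | IsCompactOperator T} isCompactOperator_zero (fun hS hT => hS.add hT)
    (fun hT => hT.neg) (fun {S _} hT => hT.clm_comp S) (fun {_ S} hT => hT.comp_clm S)

theorem mem_compactOperatorIdeal {𝕜 E : Type*} [NontriviallyNormedField 𝕜]
    [NormedAddCommGroup E] [NormedSpace 𝕜 E] {T : E →L[𝕜] E} :
    T ∈ compactOperatorIdeal 𝕜 E ↔ IsCompactOperator T := by
  exact TwoSidedIdeal.mem_mk' _ _ _ _ _ _ _

/-- If `b` squares to zero, `b * c + c * b` commutes with `b`; when `q` inverts it modulo the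
ideal `I`, the element `c * q` is a contracting homotopy for `b` modulo `I`. -/
theorem TwoSidedIdeal.homotopy_sub_one_mem {R : Type*} [Ring R] (I : TwoSidedIdeal R)
    {b c q : R} (hb : b * b = 0) (hright : (b * c + c * b) * q - 1 ∈ I)
    (hleft : q * (b * c + c * b) - 1 ∈ I) :
    b * (c * q) + c * q * b - 1 ∈ I := by
  have hcomm : b * (b * c + c * b) = (b * c + c * b) * b := by
    simp only [mul_add, add_mul, mul_assoc, hb]
    simp only [← mul_assoc, hb, zero_mul, mul_zero, zero_add, add_zero]
  have hqb : (q * (b * c + c * b) - 1) * (b * q) - q * b * ((b * c + c * b) * q - 1) =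
      q * b - b * q := by
    have h : q * b * ((b * c + c * b) * q) = q * (b * c + c * b) * (b * q) := by
      simpa only [mul_assoc] using congrArg (fun x => q * x * q) hcomm
    rw [sub_mul, mul_sub, h]
    noncomm_ring
  have hmem : q * b - b * q ∈ I :=
    hqb ▸ I.sub_mem (I.mul_mem_right _ _ hleft) (I.mul_mem_left _ _ hright)
  have hsum : b * (c * q) + c * q * b - 1 =
      ((b * c + c * b) * q - 1) + c * (q * b - b * q) := by noncomm_ring
  exact hsum ▸ I.add_mem hright (I.mul_mem_left _ _ hmem)

/-- A right inverse modulo a two-sided ideal squares to a right inverse of the square. -/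
theorem TwoSidedIdeal.sq_mul_sq_sub_one_mem {R : Type*} [Ring R] (I : TwoSidedIdeal R)
    {s p : R} (h : s * p - 1 ∈ I) : s * s * (p * p) - 1 ∈ I := by
  have heq : s * s * (p * p) - 1 = s * (s * p - 1) * p + (s * p - 1) := by noncomm_ring
  exact heq ▸ I.add_mem (I.mul_mem_right _ _ (I.mul_mem_left _ _ h)) h

/-- If `β ∘ β = 0` and the operator `S = -i(β - β*)` is invertible modulo compact
operators, then the complex `(H, β)` admits a parametrix: a bounded operator `g`
with `β ∘ g + g ∘ β - id` compact. -/
theorem stmt1 {H : Type*} [NormedAddCommGroup H] [InnerProductSpace ℂ H]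
    [CompleteSpace H] (β : H →L[ℂ] H) (hβ : β.comp β = 0)
    (hS : ∃ P : H →L[ℂ] H,
      IsCompactOperator
        ⇑(((-Complex.I) • (β - ContinuousLinearMap.adjoint β)).comp P - 1) ∧
      IsCompactOperator
        ⇑(P.comp ((-Complex.I) • (β - ContinuousLinearMap.adjoint β)) - 1)) :
    ∃ g : H →L[ℂ] H, IsCompactOperator ⇑(β.comp g + g.comp β - 1) := by
  obtain ⟨P, hSP, hPS⟩ := hS
  set S : H →L[ℂ] H := (-Complex.I) • (β - adjoint β) with hSdef
  have hβ' : β * β = 0 := hβ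
  have hadj : adjoint β * adjoint β = 0 := by
    rw [mul_def, ← adjoint_comp, hβ, map_zero]
  have hSS : S * S = β * adjoint β + adjoint β * β := by
    rw [hSdef, smul_mul_smul_comm, neg_mul_neg, Complex.I_mul_I, sub_mul, mul_sub, mul_sub,
      hβ', hadj, neg_one_smul]
    abel
  rw [← mem_compactOperatorIdeal] at hSP hPS
  refine ⟨adjoint β * (P * P), mem_compactOperatorIdeal.mp ?_⟩
  apply TwoSidedIdeal.homotopy_sub_one_mem _ hβ'
  · exact hSS ▸ TwoSidedIdeal.sq_mul_sq_sub_one_mem _ hSP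
  · exact hSS ▸ TwoSidedIdeal.sq_mul_sq_sub_one_mem _ hPS
end

section
/- Let H be a complex Hilbert space and β, g : H → H continuous linear operators such that β ∘ β = 0 and β ∘ g + g ∘ β = id + c for some compact operator c. Define g′ := g ∘ β ∘ g. Then: (a) β ∘ g′ + g′ ∘ β − id is a compact operator; (b) g′ ∘ g′ is a compact operator; (c) (β + g′) ∘ (β + g′) − id is a compact operator, so β + g′ is invertible modulo compact operators. -/
section Ring

variable {R : Type*} [Ring R] {b g c : R}

theorem parametrix_improvement_homotopy (hb : b * b = 0) (h : b * g + g * b = 1 + c) :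
    b * (g * (b * g)) + g * (b * g) * b - 1 = c + c * (b * g) + g * (c * b) := by
  obtain rfl : c = b * g + g * b - 1 := by rw [h]; abel
  have hb' (x : R) : b * (b * x) = 0 := by rw [← mul_assoc, hb, zero_mul]
  simp only [mul_add, add_mul, mul_sub, sub_mul, mul_assoc, hb, hb', mul_zero, one_mul]
  abel

theorem parametrix_improvement_sq (hb : b * b = 0) (h : b * g + g * b = 1 + c) :
    g * (b * g) * (g * (b * g)) = g * ((c + c * c - c * (b * g) - g * b * c) * g) := by
  obtain rfl : c = b * g + g * b - 1 := by rw [h]; abel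
  have hb' (x : R) : b * (b * x) = 0 := by rw [← mul_assoc, hb, zero_mul]
  simp only [mul_add, add_mul, mul_sub, sub_mul, mul_assoc, hb', mul_zero, zero_mul, one_mul, mul_one]
  abel

end Ring

/-- Improvement of a parametrix: if `β ∘ β = 0` and `β ∘ g + g ∘ β = id + c`
with `c` compact, then `g′ = g ∘ β ∘ g` is again a parametrix, `g′ ∘ g′` is
compact, and `β + g′` is invertible modulo compact operators (indeed
`(β + g′)² - id` is compact). -/
theorem stmt2 {H : Type*} [NormedAddCommGroup H] [InnerProductSpace ℂ H]
    [CompleteSpace H] (β g : H →L[ℂ] H) (hβ : β.comp β = 0)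
    (c : H →L[ℂ] H) (hc : IsCompactOperator ⇑c)
    (hpar : β.comp g + g.comp β = 1 + c) :
    IsCompactOperator ⇑(β.comp (g.comp (β.comp g)) + (g.comp (β.comp g)).comp β - 1) ∧
    IsCompactOperator ⇑((g.comp (β.comp g)).comp (g.comp (β.comp g))) ∧
    IsCompactOperator ⇑((β + g.comp (β.comp g)).comp (β + g.comp (β.comp g)) - 1) := by
  have hhom : IsCompactOperator
      ⇑(β.comp (g.comp (β.comp g)) + (g.comp (β.comp g)).comp β - 1) := by
    have e : β.comp (g.comp (β.comp g)) + (g.comp (β.comp g)).comp β - 1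
        = c + c.comp (β.comp g) + g.comp (c.comp β) :=
      parametrix_improvement_homotopy hβ hpar
    rw [e]
    exact (hc.add (hc.comp_clm (β.comp g))).add ((hc.comp_clm β).clm_comp g)
  have hsq : IsCompactOperator ⇑((g.comp (β.comp g)).comp (g.comp (β.comp g))) := by
    have e : (g.comp (β.comp g)).comp (g.comp (β.comp g))
        = g.comp ((c + c.comp c - c.comp (β.comp g) - (g.comp β).comp c).comp g) :=
      parametrix_improvement_sq hβ hpar
    have hk : IsCompactOperator ⇑(c + c.comp c - c.comp (β.comp g) - (g.comp β).comp c) :=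
      ((hc.add (hc.comp_clm c)).sub (hc.comp_clm (β.comp g))).sub (hc.clm_comp (g.comp β))
    rw [e]
    exact (hk.comp_clm g).clm_comp g
  refine ⟨hhom, hsq, ?_⟩
  have e : (β + g.comp (β.comp g)).comp (β + g.comp (β.comp g)) - 1
      = (β.comp (g.comp (β.comp g)) + (g.comp (β.comp g)).comp β - 1)
        + (g.comp (β.comp g)).comp (g.comp (β.comp g)) := by
    rw [ContinuousLinearMap.comp_add, ContinuousLinearMap.add_comp,
      ContinuousLinearMap.add_comp, hβ]
    abel
  rw [e]
  exact hhom.add hsq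
end

section
/- Let ι and κ be types, let (P i)_{i ∈ ι} and (Q j)_{j ∈ κ} be families of complex Hilbert spaces, and let M : ∀ j i, (P i →L[ℂ] Q j) be a matrix of continuous linear maps. Suppose there are K ≥ 0 and n ∈ ℕ such that ‖M j i‖ ≤ K for all j, i, for each i the set {j | M j i ≠ 0} has at most n elements, and for each j the set {i | M j i ≠ 0} has at most n elements. Then there exists a continuous linear map T : lp P 2 → lp Q 2 with ‖T‖ ≤ n·K such that for every x ∈ lp P 2 and every j ∈ κ, (T x) j = Σ_i M j i (x i) (a sum with finitely many nonzero terms). -/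
open Finset in
/-- If each `i` lies in at most `n` of the sets `R j` with `j ∈ s`, then summing a nonnegative
function over all of these sets costs at most a factor `n` over summing it over their union. -/
theorem sum_sum_le_nat_mul_sum_biUnion {ι κ : Type*} [DecidableEq ι] (s : Finset κ)
    (R : κ → Finset ι) {f : ι → ℝ} (hf : ∀ i, 0 ≤ f i) {n : ℕ}
    (hn : ∀ i, #{j ∈ s | i ∈ R j} ≤ n) :
    ∑ j ∈ s, ∑ i ∈ R j, f i ≤ n * ∑ i ∈ s.biUnion R, f i := by
  have hcomm : ∑ j ∈ s, ∑ i ∈ R j, f i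
      = ∑ i ∈ s.biUnion R, ∑ j ∈ s with i ∈ R j, f i :=
    sum_comm' fun j i => by
      simp only [mem_biUnion, mem_filter]
      exact ⟨fun h => ⟨h, j, h⟩, fun h => h.1⟩
  rw [hcomm, mul_sum]
  refine sum_le_sum fun i _ => ?_
  rw [sum_const, nsmul_eq_mul]
  exact mul_le_mul_of_nonneg_right (by exact_mod_cast hn i) (hf i)

section Matrix

variable {𝕜 ι κ : Type*} [NontriviallyNormedField 𝕜] {P : ι → Type*} {Q : κ → Type*}
  [∀ i, NormedAddCommGroup (P i)] [∀ i, NormedSpace 𝕜 (P i)]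
  [∀ j, NormedAddCommGroup (Q j)] [∀ j, NormedSpace 𝕜 (Q j)]
  {M : ∀ (j : κ) (i : ι), P i →L[𝕜] Q j} {K : ℝ} {n : ℕ}

theorem finsum_matrix_apply_eq_sum {j : κ} (hrow : {i | M j i ≠ 0}.Finite) (x : ∀ i, P i) :
    ∑ᶠ i, M j i (x i) = ∑ i ∈ hrow.toFinset, M j i (x i) :=
  finsum_eq_sum_of_support_subset _ fun i hi => by
    simp only [Set.Finite.coe_toFinset, Set.mem_ofPred_eq]
    intro h
    simp [h] at hi

/-- A row with at most `n` nonzero entries of norm at most `K` satisfies a Cauchy–Schwarz bound. -/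
theorem norm_finsum_matrix_apply_sq_le {j : κ} (hbd : ∀ i, ‖M j i‖ ≤ K)
    (hrow : {i | M j i ≠ 0}.Finite) (hn : {i | M j i ≠ 0}.ncard ≤ n) (x : ∀ i, P i) :
    ‖∑ᶠ i, M j i (x i)‖ ^ 2 ≤ n * K ^ 2 * ∑ i ∈ hrow.toFinset, ‖x i‖ ^ 2 := by
  rw [finsum_matrix_apply_eq_sum hrow]
  have hcard : (hrow.toFinset.card : ℝ) ≤ n := by
    rw [Set.ncard_eq_toFinset_card _ hrow] at hn
    exact_mod_cast hn
  calc ‖∑ i ∈ hrow.toFinset, M j i (x i)‖ ^ 2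
      ≤ (∑ i ∈ hrow.toFinset, K * ‖x i‖) ^ 2 := by
        gcongr
        exact norm_sum_le_of_le _ fun i _ => (M j i).le_of_opNorm_le (hbd i) (x i)
    _ ≤ hrow.toFinset.card * ∑ i ∈ hrow.toFinset, (K * ‖x i‖) ^ 2 := sq_sum_le_card_mul_sum_sq
    _ ≤ n * ∑ i ∈ hrow.toFinset, (K * ‖x i‖) ^ 2 := by gcongr
    _ = n * K ^ 2 * ∑ i ∈ hrow.toFinset, ‖x i‖ ^ 2 := by
        simp only [mul_pow, ← Finset.mul_sum, mul_assoc]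

theorem sum_norm_finsum_matrix_apply_sq_le (hbd : ∀ j i, ‖M j i‖ ≤ K)
    (hcol : ∀ i, {j | M j i ≠ 0}.Finite ∧ {j | M j i ≠ 0}.ncard ≤ n)
    (hrow : ∀ j, {i | M j i ≠ 0}.Finite ∧ {i | M j i ≠ 0}.ncard ≤ n)
    (x : lp P 2) (s : Finset κ) :
    ∑ j ∈ s, ‖∑ᶠ i, M j i (x i)‖ ^ 2 ≤ (n * K * ‖x‖) ^ 2 := by
  classical
  have hcount (i : ι) : (s.filter fun j => i ∈ (hrow j).1.toFinset).card ≤ n := by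
    refine le_trans ?_ (hcol i).2
    rw [← Set.ncard_coe_finset]
    exact Set.ncard_le_ncard (fun j hj => by simpa using (Finset.mem_filter.mp hj).2) (hcol i).1
  have hx (t : Finset ι) : ∑ i ∈ t, ‖x i‖ ^ 2 ≤ ‖x‖ ^ 2 := by
    simpa using lp.sum_rpow_le_norm_rpow (p := 2) (by simp) x t
  calc ∑ j ∈ s, ‖∑ᶠ i, M j i (x i)‖ ^ 2
      ≤ ∑ j ∈ s, n * K ^ 2 * ∑ i ∈ (hrow j).1.toFinset, ‖x i‖ ^ 2 :=
        Finset.sum_le_sum fun j _ =>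
          norm_finsum_matrix_apply_sq_le (hbd j) (hrow j).1 (hrow j).2 x
    _ = n * K ^ 2 * ∑ j ∈ s, ∑ i ∈ (hrow j).1.toFinset, ‖x i‖ ^ 2 := by rw [Finset.mul_sum]
    _ ≤ n * K ^ 2 * (n * ‖x‖ ^ 2) := by
        gcongr
        refine (sum_sum_le_nat_mul_sum_biUnion s _ (fun i => by positivity) hcount).trans ?_
        gcongr
        exact hx _
    _ = (n * K * ‖x‖) ^ 2 := by ring

end Matrix

/-- A uniformly bounded matrix `M` of operators between families of complex
Hilbert spaces, with at most `n` nonzero entries in each row and in each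
column, defines a bounded operator between the Hilbert direct sums, of norm at
most `n·K`, acting by matrix multiplication (each entry of the result is a sum
with finitely many nonzero terms). -/
theorem stmt7 {ι κ : Type*} (P : ι → Type*) (Q : κ → Type*)
    [∀ i, NormedAddCommGroup (P i)] [∀ i, InnerProductSpace ℂ (P i)]
    [∀ i, CompleteSpace (P i)]
    [∀ j, NormedAddCommGroup (Q j)] [∀ j, InnerProductSpace ℂ (Q j)]
    [∀ j, CompleteSpace (Q j)]
    (M : ∀ (j : κ) (i : ι), P i →L[ℂ] Q j) (K : ℝ) (hK : 0 ≤ K) (n : ℕ)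
    (hbd : ∀ j i, ‖M j i‖ ≤ K)
    (hcol : ∀ i, {j | M j i ≠ 0}.Finite ∧ {j | M j i ≠ 0}.ncard ≤ n)
    (hrow : ∀ j, {i | M j i ≠ 0}.Finite ∧ {i | M j i ≠ 0}.ncard ≤ n) :
    ∃ T : lp P 2 →L[ℂ] lp Q 2, ‖T‖ ≤ n * K ∧
      ∀ (x : lp P 2) (j : κ), (T x : ∀ j, Q j) j = ∑ᶠ i, M j i ((x : ∀ i, P i) i) := by
  have hsum (x : lp P 2) (s : Finset κ) :
      ∑ j ∈ s, ‖∑ᶠ i, M j i (x i)‖ ^ (2 : ENNReal).toReal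
        ≤ (n * K * ‖x‖) ^ (2 : ENNReal).toReal := by
    simpa using sum_norm_finsum_matrix_apply_sq_le hbd hcol hrow x s
  let L : lp P 2 →ₗ[ℂ] lp Q 2 :=
    { toFun := fun x => ⟨fun j => ∑ᶠ i, M j i (x i), memℓp_gen' (hsum x)⟩
      map_add' := fun x y => by
        ext j
        change ∑ᶠ i, M j i ((x + y : lp P 2) i) = ∑ᶠ i, M j i (x i) + ∑ᶠ i, M j i (y i)
        simp_rw [finsum_matrix_apply_eq_sum (hrow j).1, lp.coeFn_add, Pi.add_apply, map_add,
          Finset.sum_add_distrib]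
      map_smul' := fun c x => by
        ext j
        change ∑ᶠ i, M j i ((c • x : lp P 2) i) = c • ∑ᶠ i, M j i (x i)
        simp_rw [finsum_matrix_apply_eq_sum (hrow j).1, lp.coeFn_smul, Pi.smul_apply, map_smul,
          Finset.smul_sum] }
  have hL (x : lp P 2) : ‖L x‖ ≤ n * K * ‖x‖ :=
    lp.norm_le_of_forall_sum_le (by simp) (by positivity) (hsum x)
  exact ⟨L.mkContinuous (n * K) hL, L.mkContinuous_norm_le (by positivity) hL, fun _ _ => rfl⟩
end

section
/- Let ι be a type and d : ι → ℝ a function with d i ≥ 0 for all i. Suppose there are constants c ≥ 0 and C ≥ 0 such that for every natural number n the set {i | d i ≤ n} is finite and has at most C · exp(c · n) elements. Then for every real number k with k > exp c, the family i ↦ k^(−d i) is summable. -/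
/-- If the number of indices `i` with `d i ≤ n` grows at most like `C·e^{c·n}`,
then the family `i ↦ k^{-d i}` is summable for every `k > e^c`. -/
theorem stmt13 {ι : Type*} (d : ι → ℝ) (hd : ∀ i, 0 ≤ d i)
    (c C : ℝ) (hc : 0 ≤ c) (hC : 0 ≤ C)
    (hcount : ∀ n : ℕ, {i | d i ≤ (n : ℝ)}.Finite ∧
      ({i | d i ≤ (n : ℝ)}.ncard : ℝ) ≤ C * Real.exp (c * n))
    (k : ℝ) (hk : Real.exp c < k) :
    Summable fun i => k ^ (-(d i)) := by
  have hk1 : 1 < k := (Real.one_le_exp hc).trans_lt hk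
  have hk0 : 0 < k := zero_lt_one.trans hk1
  have hr0 : 0 ≤ Real.exp c / k := by positivity
  have hr1 : Real.exp c / k < 1 := (div_lt_one hk0).2 hk
  have hgeom : Summable fun n : ℕ => C * Real.exp c * (Real.exp c / k) ^ n :=
    (summable_geometric_of_lt_one hr0 hr1).mul_left _
  -- The part of the sum with `⌊d i⌋ = n` is bounded by the `n`-th term of a geometric series.
  have hfiber (s : Finset ι) (n : ℕ) : ∑ i ∈ s with ⌊d i⌋₊ = n, k ^ (-(d i)) ≤
      C * Real.exp c * (Real.exp c / k) ^ n := by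
    have hterm : ∀ i ∈ s.filter (fun i => ⌊d i⌋₊ = n), k ^ (-(d i)) ≤ (k ^ n)⁻¹ := by
      intro i hi
      rw [← Real.rpow_natCast, ← Real.rpow_neg hk0.le]
      refine Real.rpow_le_rpow_of_exponent_le hk1.le (neg_le_neg ?_)
      rw [← (Finset.mem_filter.1 hi).2]
      exact Nat.floor_le (hd i)
    have hcard : ((s.filter (fun i => ⌊d i⌋₊ = n)).card : ℝ) ≤
        C * Real.exp (c * (n + 1 : ℕ)) := by
      refine le_trans ?_ (hcount (n + 1)).2
      rw [← Set.ncard_coe_finset]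
      refine Nat.cast_le.2 (Set.ncard_le_ncard (fun i hi => ?_) (hcount (n + 1)).1)
      have hn := (Finset.mem_filter.1 (Finset.mem_coe.1 hi)).2
      have hlt := Nat.lt_floor_add_one (d i)
      rw [hn] at hlt
      simpa using hlt.le
    calc ∑ i ∈ s with ⌊d i⌋₊ = n, k ^ (-(d i))
        ≤ (s.filter (fun i => ⌊d i⌋₊ = n)).card • (k ^ n)⁻¹ := Finset.sum_le_card_nsmul _ _ _ hterm
      _ ≤ C * Real.exp (c * (n + 1 : ℕ)) * (k ^ n)⁻¹ := by
        rw [nsmul_eq_mul]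
        gcongr
      _ = C * Real.exp c * (Real.exp c / k) ^ n := by
        rw [mul_comm c, Real.exp_nat_mul, pow_succ, div_pow, div_eq_mul_inv]
        ring
  refine summable_of_sum_le (c := ∑' n : ℕ, C * Real.exp c * (Real.exp c / k) ^ n)
    (fun i => Real.rpow_nonneg hk0.le _) (fun s => ?_)
  rw [← Finset.sum_fiberwise_of_maps_to (fun i hi => Finset.mem_image_of_mem (⌊d ·⌋₊) hi)]
  exact (Finset.sum_le_sum fun n _ => hfiber s n).trans
    (hgeom.sum_le_tsum _ fun n _ => by positivity)
end

section
/- Let G be a group acting on a topological space X such that for each g ∈ G the map x ↦ g • x is continuous (hence a homeomorphism). Let S ⊆ X be a closed set such that the family of translates (g • S)_{g ∈ G} is locally finite, and let p : X → X/G be the quotient map onto the orbit space equipped with the quotient topology. If the image p(S) is compact, then S is compact. -/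
open Pointwise

/-- If the translates of a closed set `S` form a locally finite family, then the orbit map
restricted to `S` is closed. -/
theorem isClosedMap_orbitRel_mk_restrict {G X : Type*} [Group G] [TopologicalSpace X]
    [MulAction G X] [ContinuousConstSMul G X] {S : Set X} (hS : IsClosed S)
    (hlf : LocallyFinite fun g : G => g • S) :
    IsClosedMap fun s : S => Quotient.mk (MulAction.orbitRel G X) s := by
  intro C hC
  have hC' : IsClosed (Subtype.val '' C) := hS.isClosedMap_subtype_val C hC
  have hsub : Subtype.val '' C ⊆ S := Subtype.coe_image_subset S C
  rw [← isQuotientMap_quotient_mk'.isClosed_preimage,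
    ← Set.image_image (Quotient.mk (MulAction.orbitRel G X)) Subtype.val C]
  have hpre := MulAction.quotient_preimage_image_eq_union_mul (G := G) (Subtype.val '' C)
  refine hpre ▸ ?_
  exact (hlf.subset fun g => Set.smul_set_mono hsub).isClosed_iUnion fun g => hC'.smul g

/-- If the translates of `S` form a point-finite family, then the orbit map restricted to `S` has
finite fibers. -/
theorem finite_orbitRel_mk_restrict_preimage_singleton {G X : Type*} [Group G] [MulAction G X]
    {S : Set X} (hpf : ∀ x : X, {g : G | x ∈ g • S}.Finite)
    (q : Quotient (MulAction.orbitRel G X)) :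
    ((fun s : S => Quotient.mk (MulAction.orbitRel G X) s) ⁻¹' {q}).Finite := by
  induction q using Quotient.inductionOn with | _ x
  refine .of_finite_image (((hpf x).image fun g => g⁻¹ • x).subset ?_)
    Subtype.val_injective.injOn
  rintro _ ⟨s, hs, rfl⟩
  obtain ⟨h, hh : h • x = s⟩ := MulAction.orbitRel_apply.1 (Quotient.exact hs)
  refine ⟨h⁻¹, ?_, by simpa using hh⟩
  simp [Set.mem_smul_set_iff_inv_smul_mem, hh]

/-- If a group `G` acts on a topological space `X` by homeomorphisms, `S ⊆ X` is
closed, the family of translates `(g • S)` is locally finite, and the image of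
`S` in the orbit space `X/G` is compact, then `S` is compact. -/
theorem stmt15 {G X : Type*} [Group G] [TopologicalSpace X] [MulAction G X]
    (hcont : ∀ g : G, Continuous fun x : X => g • x)
    (S : Set X) (hS : IsClosed S)
    (hlf : LocallyFinite fun g : G => (g • S : Set X))
    (hcompact : IsCompact (Quotient.mk (MulAction.orbitRel G X) '' S)) :
    IsCompact S := by
  have : ContinuousConstSMul G X := ⟨hcont⟩
  have hproper : IsProperMap fun s : S => Quotient.mk (MulAction.orbitRel G X) s :=
    isProperMap_iff_isClosedMap_and_compact_fibers.2
      ⟨continuous_quotient_mk'.comp continuous_subtype_val,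
        isClosedMap_orbitRel_mk_restrict hS hlf, fun q =>
        (finite_orbitRel_mk_restrict_preimage_singleton hlf.point_finite q).isCompact⟩
  rw [isCompact_iff_isCompact_univ]
  convert hproper.isCompact_preimage hcompact
  exact (Set.eq_univ_of_forall fun s => Set.mem_image_of_mem _ s.2).symm
end
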